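/- Let n ≥ 5, N = C(n−2,2), and consider ℂ^{2N} with coordinates (c_{ij}, c'_{ij}) for 3 ≤ i < j ≤ n, and the polynomials f_{ijk} = c_{ij}·c'_{ik}·c_{jk} − c'_{ij}·c_{ik}·c'_{jk} for 3 ≤ i < j < k ≤ n. Then at every point of ℂ^{2N} at which (c_{ij}, c'_{ij}) ≠ (0,0) for every pair and f_{ijk} = 0 for every triple, the gradients ∇f_{ijk} (there are C(n−2,3) of them) span a linear subspace of ℂ^{2N} of dimension exactly M = C(n−3,2); equivalently, the Jacobian matrix of the family (f_{ijk}) has rank C(n−3,2) at every such point. -/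

import Mathlib

/-- Pairs `3 ≤ i < j ≤ n` (as elements of `Fin (n+1) × Fin (n+1)`); there are
`N = C(n-2,2)` of them, so `(PairIdx n → ℂ) × (PairIdx n → ℂ)` is `ℂ^{2N}` with
coordinates `(c_{ij}, c'_{ij})`. -/
def PairIdx (n : ℕ) : Type :=
  {p : Fin (n + 1) × Fin (n + 1) // 3 ≤ (p.1 : ℕ) ∧ (p.1 : ℕ) < (p.2 : ℕ) ∧ (p.2 : ℕ) ≤ n}

instance (n : ℕ) : Fintype (PairIdx n) := by unfold PairIdx; infer_instance

/-- The affine space `ℂ^{2N}`: a point is a pair `(c, c')` of families indexed by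
the pairs `3 ≤ i < j ≤ n`. -/
abbrev Amb (n : ℕ) : Type := (PairIdx n → ℂ) × (PairIdx n → ℂ)

/-- Triples `3 ≤ i < j < k ≤ n`; there are `C(n-2,3)` of them. -/
def TripleIdx (n : ℕ) : Type :=
  {t : Fin (n + 1) × Fin (n + 1) × Fin (n + 1) //
    3 ≤ (t.1 : ℕ) ∧ (t.1 : ℕ) < (t.2.1 : ℕ) ∧ (t.2.1 : ℕ) < (t.2.2 : ℕ) ∧ (t.2.2 : ℕ) ≤ n}

/-- The polynomial `f_{ijk} = c_{ij}·c'_{ik}·c_{jk} − c'_{ij}·c_{ik}·c'_{jk}` on `ℂ^{2N}`. -/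
def fpoly (n : ℕ) (t : TripleIdx n) (p : Amb n) : ℂ :=
  p.1 ⟨(t.1.1, t.1.2.1), t.2.1, t.2.2.1, le_trans (le_of_lt t.2.2.2.1) t.2.2.2.2⟩
    * p.2 ⟨(t.1.1, t.1.2.2), t.2.1, lt_trans t.2.2.1 t.2.2.2.1, t.2.2.2.2⟩
    * p.1 ⟨(t.1.2.1, t.1.2.2), le_trans t.2.1 (le_of_lt t.2.2.1), t.2.2.2.1, t.2.2.2.2⟩
  - p.2 ⟨(t.1.1, t.1.2.1), t.2.1, t.2.2.1, le_trans (le_of_lt t.2.2.2.1) t.2.2.2.2⟩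
    * p.1 ⟨(t.1.1, t.1.2.2), t.2.1, lt_trans t.2.2.1 t.2.2.2.1, t.2.2.2.2⟩
    * p.2 ⟨(t.1.2.1, t.1.2.2), le_trans t.2.1 (le_of_lt t.2.2.1), t.2.2.2.1, t.2.2.2.2⟩

section TriangleRelations

variable {K W : Type*} [Field K] [AddCommGroup W] [Module K W]

/-- The difference of the two cyclic products of `a` around the triangle `i, j, k`. -/
def cyclicDiff (a : ℕ → ℕ → K) (i j k : ℕ) : K :=
  a i j * a j k * a k i - a j i * a k j * a i k

/-- The formal differential of `cyclicDiff` at `a`, with `L i j` in the role of the differential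
of the coordinate `a i j`. -/
def cyclicDiffDeriv (a : ℕ → ℕ → K) (L : ℕ → ℕ → W) (i j k : ℕ) : W :=
  (a j k * a k i) • L i j + (a i j * a k i) • L j k + (a i j * a j k) • L k i
    - ((a k j * a i k) • L j i + (a j i * a i k) • L k j + (a j i * a k j) • L i k)

/-- An alternating function of three natural numbers takes values in a submodule as soon as it
does so on increasing triples. -/
theorem alternating_mem_of_increasing (S : Submodule K W) (P : ℕ → Prop) (F : ℕ → ℕ → ℕ → W)
    (h₁₂ : ∀ i j k, F j i k = -F i j k) (h₂₃ : ∀ i j k, F i k j = -F i j k)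
    (h : ∀ i j k, i < j → j < k → P i → P j → P k → F i j k ∈ S)
    {i j k : ℕ} (hij : i ≠ j) (hjk : j ≠ k) (hik : i ≠ k) (hi : P i) (hj : P j) (hk : P k) :
    F i j k ∈ S := by
  have key : ∀ i j k, i < j → j ≠ k → i ≠ k → P i → P j → P k → F i j k ∈ S := by
    intro i j k hij hjk hik hi hj hk
    rcases lt_or_gt_of_ne hjk with h1 | h1
    · exact h i j k hij h1 hi hj hk
    · rw [h₂₃ i k j]
      refine S.neg_mem ?_
      rcases lt_or_gt_of_ne hik with h2 | h2
      · exact h i k j h2 h1 hi hk hj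
      · rw [h₁₂ k i j]
        exact S.neg_mem (h k i j h2 hij hk hi hj)
  rcases lt_or_gt_of_ne hij with h1 | h1
  · exact key i j k h1 hjk hik hi hj hk
  · rw [h₁₂ j i k]
    exact S.neg_mem (key j i k h1 hik hjk hj hi hk)

theorem cyclicDiff_swap₁₂ (a : ℕ → ℕ → K) (i j k : ℕ) :
    cyclicDiff a j i k = -cyclicDiff a i j k := by
  simp only [cyclicDiff]; ring

theorem cyclicDiff_swap₂₃ (a : ℕ → ℕ → K) (i j k : ℕ) :
    cyclicDiff a i k j = -cyclicDiff a i j k := by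
  simp only [cyclicDiff]; ring

theorem cyclicDiffDeriv_swap₁₂ (a : ℕ → ℕ → K) (L : ℕ → ℕ → W) (i j k : ℕ) :
    cyclicDiffDeriv a L j i k = -cyclicDiffDeriv a L i j k := by
  simp only [cyclicDiffDeriv]; module

theorem cyclicDiffDeriv_swap₂₃ (a : ℕ → ℕ → K) (L : ℕ → ℕ → W) (i j k : ℕ) :
    cyclicDiffDeriv a L i k j = -cyclicDiffDeriv a L i j k := by
  simp only [cyclicDiffDeriv]; module

/-- In the chart `a j i ≠ 0`, `cyclicDiffDeriv` is a multiple of the differential of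
`z i j * z j k - z i k`, where `z i j = a i j / a j i`. -/
theorem cyclicDiffDeriv_eq_smul (a : ℕ → ℕ → K) (L : ℕ → ℕ → W) {i j k : ℕ}
    (hji : a j i ≠ 0) (hkj : a k j ≠ 0) (hki : a k i ≠ 0) (h : cyclicDiff a i j k = 0)
    (D : ℕ → ℕ → W)
    (hD : ∀ p q, D p q = (a q p)⁻¹ • L p q - (a p q / a q p ^ 2) • L q p) :
    cyclicDiffDeriv a L i j k = (a j i * a k j * a k i) •
      ((a i j / a j i) • D j k + (a j k / a k j) • D i j - D i k) := by
  have hik : a i k = a i j * a j k * a k i / (a j i * a k j) := by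
    rw [cyclicDiff] at h
    field_simp
    linear_combination -h
  simp only [hD, cyclicDiffDeriv, hik]
  match_scalars <;> field_simp

theorem ratio_mul_of_cyclicDiff_eq_zero (a : ℕ → ℕ → K) {i j k : ℕ}
    (hji : a j i ≠ 0) (hkj : a k j ≠ 0) (hki : a k i ≠ 0) (h : cyclicDiff a i j k = 0) :
    a i k / a k i = (a i j / a j i) * (a j k / a k j) := by
  rw [cyclicDiff] at h
  field_simp
  linear_combination -h

/-- The tetrahedron relation expressing the face `p, q, r` through the other three faces. -/
theorem cyclicDiffDeriv_mem_of_faces (a : ℕ → ℕ → K) (L : ℕ → ℕ → W) (S : Submodule K W)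
    {p q s r : ℕ} (hqp : a q p ≠ 0) (hsp : a s p ≠ 0) (hrp : a r p ≠ 0) (hsq : a s q ≠ 0)
    (hrq : a r q ≠ 0) (hrs : a r s ≠ 0)
    (hpqr : cyclicDiff a p q r = 0) (hpqs : cyclicDiff a p q s = 0)
    (hpsr : cyclicDiff a p s r = 0) (hqsr : cyclicDiff a q s r = 0)
    (h₁ : cyclicDiffDeriv a L p s r ∈ S) (h₂ : cyclicDiffDeriv a L p q s ∈ S)
    (h₃ : cyclicDiffDeriv a L q s r ∈ S) : cyclicDiffDeriv a L p q r ∈ S := by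
  set D : ℕ → ℕ → W := fun p q => (a q p)⁻¹ • L p q - (a p q / a q p ^ 2) • L q p
  have hD' : ∀ p q, D p q = (a q p)⁻¹ • L p q - (a p q / a q p ^ 2) • L q p := fun _ _ => rfl
  rw [cyclicDiffDeriv_eq_smul a L hsp hrs hrp hpsr D hD', S.smul_mem_iff (by positivity)] at h₁
  rw [cyclicDiffDeriv_eq_smul a L hqp hsq hsp hpqs D hD', S.smul_mem_iff (by positivity)] at h₂
  rw [cyclicDiffDeriv_eq_smul a L hsq hrs hrq hqsr D hD', S.smul_mem_iff (by positivity)] at h₃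
  rw [cyclicDiffDeriv_eq_smul a L hqp hrq hrp hpqr D hD', S.smul_mem_iff (by positivity)]
  rw [ratio_mul_of_cyclicDiff_eq_zero a hqp hsq hsp hpqs] at h₁
  rw [ratio_mul_of_cyclicDiff_eq_zero a hsq hrs hrq hqsr]
  have := S.sub_mem (S.add_mem h₁ (S.smul_mem (a s r / a r s) h₂))
    (S.smul_mem (a p q / a q p) h₃)
  convert this using 1
  module

theorem linearIndependent_of_triangular {ι : Type*} [Fintype ι] (v : ι → W)
    (φ : ι → W →ₗ[K] K) (ρ : ι → ℕ) (hdiag : ∀ i, φ i (v i) ≠ 0)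
    (htri : ∀ i j, j ≠ i → ρ j ≤ ρ i → φ i (v j) = 0) : LinearIndependent K v := by
  classical
  rw [Fintype.linearIndependent_iff]
  intro g hg
  by_contra! hne
  obtain ⟨i₀, hi₀⟩ := hne
  obtain ⟨i, hi, hmax⟩ := (Finset.univ.filter fun i => g i ≠ 0).exists_max_image ρ
    ⟨i₀, by simpa using hi₀⟩
  have h := congrArg (φ i) hg
  rw [map_sum, map_zero, Finset.sum_eq_single i] at h
  · simp only [map_smul, smul_eq_mul, mul_eq_zero, hdiag, or_false] at h
    simp [h] at hi
  · intro j _ hj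
    by_cases h0 : g j = 0
    · simp [h0]
    · simp [htri i j hj (hmax j (by simpa using h0))]
  · simp

/-- The rank of the triangle relations in the chart where all `a q p` with `p < q` are
nonzero. -/
theorem finrank_span_cyclicDiffDeriv (m : ℕ) (a : ℕ → ℕ → K) (L : ℕ → ℕ → W)
    (E : ℕ → ℕ → W →ₗ[K] K)
    (hE : ∀ p q p' q', p < m → q < m → p' < m → q' < m → p' ≠ q' →
      E p q (L p' q') = if p' = p ∧ q' = q then 1 else 0)
    (ha : ∀ p q, p < q → q < m → a q p ≠ 0)
    (hrel : ∀ p q r, p < q → q < r → r < m → cyclicDiff a p q r = 0) :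
    Module.finrank K (Submodule.span K
      {w | ∃ p q r, p < q ∧ q < r ∧ r < m ∧ cyclicDiffDeriv a L p q r = w})
      = Nat.choose (m - 1) 2 := by
  let v : (Σ s : Fin (m - 1), Fin s) → W := fun x => cyclicDiffDeriv a L x.2 x.1 (x.1 + 1)
  have hspan : Submodule.span K
      {w | ∃ p q r, p < q ∧ q < r ∧ r < m ∧ cyclicDiffDeriv a L p q r = w}
      = Submodule.span K (Set.range v) := by
    apply le_antisymm
    · rw [Submodule.span_le]
      rintro _ ⟨p, q, r, hpq, hqr, hr, rfl⟩
      induction r, hqr using Nat.le_induction generalizing p with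
      | base => exact Submodule.subset_span ⟨⟨⟨q, by omega⟩, ⟨p, hpq⟩⟩, rfl⟩
      | succ r hqr ih =>
        have face : ∀ p, p < r → cyclicDiffDeriv a L p r (r + 1) ∈
            Submodule.span K (Set.range v) := fun p hp =>
          Submodule.subset_span ⟨⟨⟨r, by omega⟩, ⟨p, hp⟩⟩, rfl⟩
        apply cyclicDiffDeriv_mem_of_faces a L _ (s := r) _ _ _ _ _ _ _ _ _ _
          (face p (by omega)) (ih p hpq (by omega)) (face q (by omega))
        all_goals first
          | (apply ha <;> omega)
          | (apply hrel <;> omega)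
    · rw [Submodule.span_le]
      rintro _ ⟨⟨⟨s, hs⟩, ⟨p, hp⟩⟩, rfl⟩
      exact Submodule.subset_span ⟨p, s, s + 1, hp, by omega, by omega, rfl⟩
  have hv : LinearIndependent K v := by
    refine linearIndependent_of_triangular v (fun x => E x.2 (x.1 + 1)) (fun x => x.1) ?_ ?_
    · rintro ⟨⟨s, hs⟩, ⟨p, hp⟩⟩
      have hp' : p < s := hp
      have h1 := ha p s hp' (by omega)
      have h2 := ha s (s + 1) (by omega) (by omega)
      simp only [v, cyclicDiffDeriv, map_add, map_sub, map_smul]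
      repeat rw [hE _ _ _ _ (by omega) (by omega) (by omega) (by omega) (by omega)]
      have hsp : s ≠ p := by omega
      have hsp1 : s + 1 ≠ p := by omega
      simp [hsp, hsp1, h1, h2]
    · rintro ⟨⟨s, hs⟩, ⟨p, hp⟩⟩ ⟨⟨s', hs'⟩, ⟨p', hp'⟩⟩ hne hle
      have hp1 : p < s := hp
      have hp2 : p' < s' := hp'
      have hle' : s' ≤ s := hle
      have hne' : ¬ (p' = p ∧ s' = s) := by
        rintro ⟨rfl, rfl⟩
        exact hne rfl
      simp only [v, cyclicDiffDeriv, map_add, map_sub, map_smul]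
      repeat rw [hE _ _ _ _ (by omega) (by omega) (by omega) (by omega) (by omega)]
      repeat rw [if_neg (by omega)]
      simp
  rw [hspan, finrank_span_eq_card hv]
  simp only [Fintype.card_sigma, Fintype.card_fin]
  rw [Fin.sum_univ_eq_sum_range (fun i => i), Finset.sum_range_id, Nat.choose_two_right]

/-- If opposite entries of `a` never vanish simultaneously and all cyclic differences vanish,
then the indices can be ordered so that `a` is nonzero below the diagonal. -/
theorem exists_perm_ne_zero_of_cyclicDiff_eq_zero {m : ℕ} (a : Fin m → Fin m → K)
    (hne : ∀ i j, i ≠ j → a i j ≠ 0 ∨ a j i ≠ 0)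
    (hrel : ∀ i j k, i ≠ j → j ≠ k → i ≠ k →
      a i j * a j k * a k i = a j i * a k j * a i k) :
    ∃ σ : Equiv.Perm (Fin m), ∀ p q, p < q → a (σ q) (σ p) ≠ 0 := by
  classical
  let r : Fin m → Fin m → Prop := fun i j => i = j ∨ a j i ≠ 0
  have htrans : ∀ i j k, r i j → r j k → r i k := by
    intro i j k hij hjk
    by_cases h1 : i = j
    · exact h1 ▸ hjk
    by_cases h2 : j = k
    · exact h2 ▸ hij
    by_cases h3 : i = k
    · exact Or.inl h3
    have hij := hij.resolve_left h1
    have hjk := hjk.resolve_left h2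
    refine Or.inr fun h0 => ?_
    have hik := (hne i k h3).resolve_right (not_not.2 h0)
    have := hrel i j k h1 h2 h3
    rw [h0, mul_zero] at this
    exact mul_ne_zero (mul_ne_zero hij hjk) hik this.symm
  let down : Fin m → Finset (Fin m) := fun i => Finset.univ.filter fun j => r j i
  let f : Fin m → ℕ := fun i => (down i).card
  refine ⟨Tuple.sort f, fun p q hpq h0 => ?_⟩
  have hmono : f (Tuple.sort f p) ≤ f (Tuple.sort f q) := Tuple.monotone_sort f hpq.le
  have hpq' : Tuple.sort f p ≠ Tuple.sort f q := fun h => hpq.ne ((Tuple.sort f).injective h)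
  generalize Tuple.sort f p = i at *
  generalize Tuple.sort f q = j at *
  have hji : r j i := Or.inr ((hne i j hpq').resolve_right (not_not.2 h0))
  refine hmono.not_gt (Finset.card_lt_card (Finset.ssubset_iff_subset_ne.2 ⟨?_, ?_⟩))
  · intro l hl
    simp only [down, Finset.mem_filter, Finset.mem_univ, true_and] at hl ⊢
    exact htrans l j i hl hji
  · intro h
    have hi : i ∈ down i := by simp [down, r]
    rw [← h] at hi
    simp only [down, Finset.mem_filter, Finset.mem_univ, true_and] at hi
    exact hi.elim hpq' (fun h => h h0)

end TriangleRelations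

/-- The coordinate `c_{ij}` for `i < j`, and `c'_{ji}` for `j < i`, as a linear functional. -/
noncomputable def coordFunctional (n i j : ℕ) : Amb n →L[ℂ] ℂ :=
  if h : 3 ≤ i ∧ i < j ∧ j ≤ n then
    (ContinuousLinearMap.proj (R := ℂ) (φ := fun _ : PairIdx n => ℂ)
      ⟨(⟨i, by omega⟩, ⟨j, by omega⟩), h⟩).comp (ContinuousLinearMap.fst ℂ _ _)
  else if h : 3 ≤ j ∧ j < i ∧ i ≤ n then
    (ContinuousLinearMap.proj (R := ℂ) (φ := fun _ : PairIdx n => ℂ)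
      ⟨(⟨j, by omega⟩, ⟨i, by omega⟩), h⟩).comp (ContinuousLinearMap.snd ℂ _ _)
  else 0

theorem coordFunctional_of_lt {n i j : ℕ} (h : 3 ≤ i ∧ i < j ∧ j ≤ n) (y : Amb n) :
    coordFunctional n i j y = y.1 ⟨(⟨i, by omega⟩, ⟨j, by omega⟩), h⟩ := by
  rw [coordFunctional, dif_pos h]; rfl

theorem coordFunctional_of_gt {n i j : ℕ} (h : 3 ≤ j ∧ j < i ∧ i ≤ n) (y : Amb n) :
    coordFunctional n i j y = y.2 ⟨(⟨j, by omega⟩, ⟨i, by omega⟩), h⟩ := by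
  rw [coordFunctional, dif_neg (by omega), dif_pos h]; rfl

/-- The unit vector of the coordinate `coordFunctional n i j`. -/
def coordVector (n i j : ℕ) : Amb n :=
  (fun P => if (P.1.1 : ℕ) = i ∧ (P.1.2 : ℕ) = j then 1 else 0,
    fun P => if (P.1.2 : ℕ) = i ∧ (P.1.1 : ℕ) = j then 1 else 0)

theorem coordFunctional_coordVector {n i' j' : ℕ} (i j : ℕ) (hi' : 3 ≤ i' ∧ i' ≤ n)
    (hj' : 3 ≤ j' ∧ j' ≤ n) (hne : i' ≠ j') :
    coordFunctional n i' j' (coordVector n i j) = if i' = i ∧ j' = j then 1 else 0 := by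
  rcases lt_or_gt_of_ne hne with h | h
  · rw [coordFunctional_of_lt (by omega)]; rfl
  · rw [coordFunctional_of_gt (by omega)]; rfl

theorem fpoly_eq_cyclicDiff (n : ℕ) (t : TripleIdx n) (y : Amb n) :
    fpoly n t y = cyclicDiff (fun i j => coordFunctional n i j y) t.1.1 t.1.2.1 t.1.2.2 := by
  obtain ⟨⟨i, j, k⟩, h⟩ := t
  have h' : 3 ≤ (i : ℕ) ∧ (i : ℕ) < j ∧ (j : ℕ) < k ∧ (k : ℕ) ≤ n := h
  simp only [cyclicDiff]
  rw [coordFunctional_of_lt (i := i) (j := j) (by omega),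
    coordFunctional_of_lt (i := j) (j := k) (by omega),
    coordFunctional_of_lt (i := i) (j := k) (by omega),
    coordFunctional_of_gt (i := j) (j := i) (by omega),
    coordFunctional_of_gt (i := k) (j := j) (by omega),
    coordFunctional_of_gt (i := k) (j := i) (by omega)]
  simp only [fpoly, Fin.eta]
  ring

theorem fderiv_fpoly (n : ℕ) (t : TripleIdx n) (x : Amb n) :
    fderiv ℂ (fpoly n t) x = cyclicDiffDeriv (fun i j => coordFunctional n i j x)
      (coordFunctional n) t.1.1 t.1.2.1 t.1.2.2 := by
  rw [funext (fpoly_eq_cyclicDiff n t)]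
  have hL : ∀ i j, HasFDerivAt (fun y => coordFunctional n i j y) (coordFunctional n i j) x :=
    fun i j => (coordFunctional n i j).hasFDerivAt
  refine HasFDerivAt.fderiv (((((hL _ _).mul (hL _ _)).mul (hL _ _)).sub
    (((hL _ _).mul (hL _ _)).mul (hL _ _))).congr_fderiv ?_)
  simp only [cyclicDiffDeriv, Pi.mul_apply]
  module

theorem card_tripleIdx (n : ℕ) : Nat.card (TripleIdx n) = Nat.choose (n - 2) 3 := by
  let e : TripleIdx n ≃ Σ k : Fin (n - 2), Σ j : Fin k, Fin j :=
    { toFun := fun t => ⟨⟨t.1.2.2 - 3, by have := t.2; omega⟩,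
        ⟨⟨t.1.2.1 - 3, by have := t.2; simp only; omega⟩,
          ⟨t.1.1 - 3, by have := t.2; simp only; omega⟩⟩⟩
      invFun := fun s => ⟨(⟨s.2.2 + 3, by omega⟩, ⟨s.2.1 + 3, by omega⟩, ⟨s.1 + 3, by omega⟩),
        by simp only; omega⟩
      left_inv := by
        rintro ⟨⟨⟨i, hi⟩, ⟨j, hj⟩, ⟨k, hk⟩⟩, h⟩
        simp only at h
        apply Subtype.ext
        simp only [Prod.mk.injEq, Fin.mk.injEq]
        omega
      right_inv := by
        rintro ⟨⟨k, hk⟩, ⟨j, hj⟩, ⟨i, hi⟩⟩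
        rfl }
  rw [Nat.card_congr e, Nat.card_eq_fintype_card]
  simp only [Fintype.card_sigma, Fintype.card_fin]
  have h : ∀ k : ℕ, ∑ j : Fin k, (j : ℕ) = k.choose 2 := fun k => by
    rw [Fin.sum_univ_eq_sum_range (fun i => i), Finset.sum_range_id, Nat.choose_two_right]
  simp only [h]
  rw [Fin.sum_univ_eq_sum_range (fun i => i.choose 2)]
  induction n - 2 with
  | zero => rfl
  | succ m ih => rw [Finset.sum_range_succ, ih, Nat.choose_succ_succ' m 2, add_comm]

/-- For `n ≥ 5`, at every point of `ℂ^{2N}` with `(c_{ij}, c'_{ij}) ≠ (0,0)`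
for every pair and `f_{ijk} = 0` for every triple, the gradients `∇f_{ijk}`
(there are `C(n-2,3)` of them) span a subspace of dimension exactly `M = C(n-3,2)`;
i.e. the Jacobian of the family `(f_{ijk})` has rank `C(n-3,2)` at every such point. -/
theorem statement3 (n : ℕ) (hn : 5 ≤ n) (x : Amb n)
    (hx : ∀ P : PairIdx n, (x.1 P, x.2 P) ≠ (0, 0))
    (hrel : ∀ t : TripleIdx n, fpoly n t x = 0) :
    Nat.card (TripleIdx n) = Nat.choose (n - 2) 3 ∧
    Module.finrank ℂ
        ↥(Submodule.span ℂ (Set.range fun t : TripleIdx n => fderiv ℂ (fpoly n t) x))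
      = Nat.choose (n - 3) 2 := by
  refine ⟨card_tripleIdx n, ?_⟩
  set a : ℕ → ℕ → ℂ := fun i j => coordFunctional n i j x with ha
  let V : ℕ → Prop := fun i => 3 ≤ i ∧ i ≤ n
  have hcyc : ∀ i j k, i ≠ j → j ≠ k → i ≠ k → V i → V j → V k → cyclicDiff a i j k = 0 := by
    intro i j k hij hjk hik hi hj hk
    refine (Submodule.mem_bot ℂ).1 (alternating_mem_of_increasing ⊥ V (cyclicDiff a)
      (cyclicDiff_swap₁₂ a) (cyclicDiff_swap₂₃ a) ?_ hij hjk hik hi hj hk)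
    intro i j k hij hjk hi hj hk
    exact (Submodule.mem_bot ℂ).2 ((fpoly_eq_cyclicDiff n
      ⟨(⟨i, by omega⟩, ⟨j, by omega⟩, ⟨k, by omega⟩), hi.1, hij, hjk, hk.2⟩ x).symm.trans (hrel _))
  have hlt : ∀ i j, i < j → V i → V j → a i j ≠ 0 ∨ a j i ≠ 0 := by
    intro i j hij hi hj
    have := hx ⟨(⟨i, by omega⟩, ⟨j, by omega⟩), hi.1, hij, hj.2⟩
    simp only [ha]
    rw [coordFunctional_of_lt ⟨hi.1, hij, hj.2⟩, coordFunctional_of_gt ⟨hi.1, hij, hj.2⟩]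
    rwa [Ne, Prod.mk.injEq, not_and_or] at this
  have hV : ∀ p : Fin (n - 2), V (p + 3) := fun p => ⟨by omega, by omega⟩
  obtain ⟨σ, hσ⟩ := exists_perm_ne_zero_of_cyclicDiff_eq_zero
    (fun i j : Fin (n - 2) => a (i + 3) (j + 3))
    (fun i j hij => by
      have hij' : (i : ℕ) ≠ j := fun h => hij (Fin.ext h)
      rcases lt_or_gt_of_ne hij' with h | h
      · exact hlt _ _ (by omega) (hV i) (hV j)
      · exact (hlt _ _ (by omega) (hV j) (hV i)).symm)
    (fun i j k hij hjk hik => sub_eq_zero.1 (hcyc _ _ _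
      (by omega) (by omega) (by omega) (hV i) (hV j) (hV k)))
  let τ : ℕ → ℕ := fun p => if h : p < n - 2 then σ ⟨p, h⟩ + 3 else 0
  have hτ : ∀ p (h : p < n - 2), τ p = σ ⟨p, h⟩ + 3 := fun p h => dif_pos h
  have hτV : ∀ p, p < n - 2 → V (τ p) := fun p h => hτ p h ▸ hV _
  have hτinj : ∀ p q, p < n - 2 → q < n - 2 → (τ p = τ q ↔ p = q) := by
    intro p q hp hq
    rw [hτ p hp, hτ q hq, Nat.add_right_cancel_iff, Fin.val_inj, σ.injective.eq_iff,
      Fin.mk.injEq]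
  have hτsurj : ∀ i, V i → ∃ p, p < n - 2 ∧ τ p = i := by
    intro i hi
    have hi' : i - 3 < n - 2 := by have := hi.1; have := hi.2; omega
    refine ⟨σ.symm ⟨i - 3, hi'⟩, (σ.symm _).2, ?_⟩
    rw [hτ _ (σ.symm _).2, Fin.eta, σ.apply_symm_apply]
    exact Nat.sub_add_cancel hi.1
  let L : ℕ → ℕ → (Amb n →L[ℂ] ℂ) := coordFunctional n
  have hrank := finrank_span_cyclicDiffDeriv (n - 2) (fun p q => a (τ p) (τ q))
    (fun p q => L (τ p) (τ q))
    (fun p q => (ContinuousLinearMap.apply ℂ ℂ (coordVector n (τ p) (τ q))).toLinearMap)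
    (fun p q p' q' hp hq hp' hq' hne => by
      have := coordFunctional_coordVector (τ p) (τ q) (hτV p' hp') (hτV q' hq')
        (fun h => hne ((hτinj _ _ hp' hq').1 h))
      simp only [hτinj _ _ hp' hp, hτinj _ _ hq' hq] at this
      exact this)
    (fun p q hpq hq => by
      have := hσ ⟨p, by omega⟩ ⟨q, hq⟩ hpq
      rwa [← hτ, ← hτ] at this)
    (fun p q r hpq hqr hr => hcyc _ _ _
      (fun h => by have := (hτinj _ _ (by omega) (by omega)).1 h; omega)
      (fun h => by have := (hτinj _ _ (by omega) (by omega)).1 h; omega)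
      (fun h => by have := (hτinj _ _ (by omega) (by omega)).1 h; omega)
      (hτV _ (by omega)) (hτV _ (by omega)) (hτV _ hr))
  rw [show n - 3 = n - 2 - 1 by omega, ← hrank]
  refine congrArg (fun S : Submodule ℂ (Amb n →L[ℂ] ℂ) => Module.finrank ℂ S) ?_
  apply le_antisymm <;> rw [Submodule.span_le]
  · rintro _ ⟨t, rfl⟩
    have ht := t.2
    obtain ⟨p, hp, hpi⟩ := hτsurj t.1.1 ⟨by omega, by omega⟩
    obtain ⟨q, hq, hqj⟩ := hτsurj t.1.2.1 ⟨by omega, by omega⟩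
    obtain ⟨r, hr, hrk⟩ := hτsurj t.1.2.2 ⟨by omega, by omega⟩
    simp only [fderiv_fpoly]
    rw [← hpi, ← hqj, ← hrk]
    refine alternating_mem_of_increasing _ (· < n - 2)
      (fun p q r => cyclicDiffDeriv a L (τ p) (τ q) (τ r))
      (fun _ _ _ => cyclicDiffDeriv_swap₁₂ a L _ _ _)
      (fun _ _ _ => cyclicDiffDeriv_swap₂₃ a L _ _ _)
      ?_ ?_ ?_ ?_ hp hq hr
    · intro p q r hpq hqr _ _ hr
      exact Submodule.subset_span ⟨p, q, r, hpq, hqr, hr, rfl⟩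
    all_goals rintro rfl; omega
  · rintro _ ⟨p, q, r, hpq, hqr, hr, rfl⟩
    refine alternating_mem_of_increasing _ V (cyclicDiffDeriv a L)
      (cyclicDiffDeriv_swap₁₂ a L) (cyclicDiffDeriv_swap₂₃ a L) ?_ ?_ ?_ ?_
      (hτV _ (by omega)) (hτV _ (by omega)) (hτV _ hr)
    · intro i j k hij hjk hi hj hk
      exact Submodule.subset_span ⟨⟨(⟨i, by omega⟩, ⟨j, by omega⟩, ⟨k, by omega⟩),
        hi.1, hij, hjk, hk.2⟩, fderiv_fpoly _ _ _⟩
    all_goals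
      rw [Ne, hτinj _ _ (by omega) (by omega)]
      omega
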